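/- arXiv:math/0311258 — 2 statements merged into one kernel-verified Lean document; each statement's English description precedes it below -/
import Mathlib

section
/- Let λ be an element of the root lattice Q. Then the inversion set of w_λ^{-1} is exactly the set of positive roots having negative inner product with λ; that is, Π(w_λ^{-1}) = {α ∈ R^+ : (λ,α) < 0}. -/
open scoped RealInnerProductSpace

attribute [local instance] Classical.propDecidable

noncomputable section

/-- The reflection in the hyperplane orthogonal to `α`. -/
def sref {V : Type*} [NormedAddCommGroup V] [InnerProductSpace ℝ V] (α x : V) : V :=
  x - (2 * ⟪x, α⟫ / ⟪α, α⟫) • α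

/-- The coroot `α^∨ = 2α/(α,α)`. -/
def coroot {V : Type*} [NormedAddCommGroup V] [InnerProductSpace ℝ V] (α : V) : V :=
  (2 / ⟪α, α⟫) • α

/-- The data of a finite reduced irreducible crystallographic root system `R` in a real
inner product space, together with a fixed choice of positive roots and simple roots. -/
structure RSD (V : Type*) [NormedAddCommGroup V] [InnerProductSpace ℝ V] where
  R : Finset V
  Rpos : Finset V
  n : ℕ
  npos : 0 < n
  simple : Fin n → V
  simple_mem : ∀ i, simple i ∈ Rpos
  pos_sub : Rpos ⊆ R
  root_ne_zero : ∀ α ∈ R, α ≠ 0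
  pos_or_neg : ∀ α ∈ R, α ∈ Rpos ∨ -α ∈ Rpos
  not_both : ∀ α ∈ Rpos, -α ∉ Rpos
  pos_combo : ∀ α ∈ Rpos, ∃ c : Fin n → ℕ, α = ∑ i, (c i : ℝ) • simple i
  simple_indep : LinearIndependent ℝ simple
  reduced : ∀ α ∈ R, ∀ c : ℝ, c • α ∈ R → c = 1 ∨ c = -1
  crystal : ∀ α ∈ R, ∀ β ∈ R, ∃ k : ℤ, ⟪β, coroot α⟫ = (k : ℝ)
  refl_mem : ∀ α ∈ R, ∀ β ∈ R, sref α β ∈ R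
  spanning : Submodule.span ℝ (R : Set V) = ⊤
  irred : ∀ s : Set V, (∀ α ∈ R, ∀ β ∈ R, α ∈ s → β ∉ s → ⟪α, β⟫ = 0) →
    (∀ α ∈ R, α ∈ s) ∨ (∀ α ∈ R, α ∉ s)

namespace RSD

variable {V : Type*} [NormedAddCommGroup V] [InnerProductSpace ℝ V]

/-- The map of `V` determined by a word in the simple reflections. -/
def wordMap (S : RSD V) (l : List (Fin S.n)) : V → V :=
  l.foldr (fun i f => sref (S.simple i) ∘ f) id

/-- `w : V → V` is an element of the Weyl group `W`, i.e. a product of simple reflections. -/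
def IsWeyl (S : RSD V) (w : V → V) : Prop := ∃ l : List (Fin S.n), w = S.wordMap l

/-- The length `ℓ(w)` of a Weyl group element: the smallest length of a word in the simple
reflections representing `w`. -/
def len (S : RSD V) (w : V → V) : ℕ :=
  sInf {k | ∃ l : List (Fin S.n), l.length = k ∧ w = S.wordMap l}

/-- `x` and `y` lie in the same Weyl group orbit. -/
def sameOrbit (S : RSD V) (x y : V) : Prop := ∃ w, S.IsWeyl w ∧ w x = y

/-- `x` is dominant: `(x, α_i) ≥ 0` for all simple roots. -/
def Dominant (S : RSD V) (x : V) : Prop := ∀ i, 0 ≤ ⟪x, S.simple i⟫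

/-- `w` is a Weyl group element of minimal length among those sending `x` to `y`. -/
def IsMinWord (S : RSD V) (x y : V) (w : V → V) : Prop :=
  S.IsWeyl w ∧ w x = y ∧ ∀ w' : V → V, S.IsWeyl w' → w' x = y → S.len w ≤ S.len w'

/-- Membership in the root lattice `Q`, the ℤ-span of the simple roots. -/
def inQ (S : RSD V) (x : V) : Prop :=
  ∃ c : Fin S.n → ℤ, x = ∑ i, (c i : ℝ) • S.simple i

/-- The height `ht(λ) = Σ a_i` of an element `λ = Σ a_i α_i` of the root lattice
(the coefficients are unique since the simple roots are linearly independent). -/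
def htZ (S : RSD V) (x : V) : ℤ :=
  if h : ∃ c : Fin S.n → ℤ, x = ∑ i, (c i : ℝ) • S.simple i then ∑ i, h.choose i else 0

/-- The inversion set `Π(w) = {α ∈ R⁺ : w(α) ∈ R⁻}`. -/
def PiSet (S : RSD V) (w : V → V) : Finset V :=
  S.Rpos.filter (fun α => -(w α) ∈ S.Rpos)

/-- `α` is a short root (if all roots have the same length, all roots are short). -/
def IsShort (S : RSD V) (α : V) : Prop :=
  α ∈ S.R ∧ ∀ β ∈ S.R, ⟪α, α⟫ ≤ ⟪β, β⟫

/-- `α` is a long root. -/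
def IsLong (S : RSD V) (α : V) : Prop :=
  α ∈ S.R ∧ ∀ β ∈ S.R, ⟪β, β⟫ ≤ ⟪α, α⟫

/-- The short roots in the inversion set `Π(w)`. -/
def PiS (S : RSD V) (w : V → V) : Finset V :=
  (S.PiSet w).filter (fun α => S.IsShort α)

/-- The long roots in the inversion set `Π(w)`. -/
def PiL (S : RSD V) (w : V → V) : Finset V :=
  (S.PiSet w).filter (fun α => S.IsLong α)

end RSD


section Reflection

variable {V : Type*} [NormedAddCommGroup V] [InnerProductSpace ℝ V]

lemma sref_sref {α : V} (hα : α ≠ 0) (x : V) : sref α (sref α x) = x := by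
  have h : ⟪α, α⟫ ≠ 0 := inner_self_ne_zero.mpr hα
  have hc : 2 * ⟪sref α x, α⟫ / ⟪α, α⟫ = -(2 * ⟪x, α⟫ / ⟪α, α⟫) := by
    simp only [sref, inner_sub_left, real_inner_smul_left]
    field_simp
    ring
  rw [sref, hc, neg_smul, sub_neg_eq_add, sref, sub_add_cancel]

lemma sref_eq_self_of_inner_eq_zero {α x : V} (h : ⟪x, α⟫ = 0) : sref α x = x := by
  simp [sref, h]

lemma inner_sref_sref {α : V} (hα : α ≠ 0) (x y : V) : ⟪sref α x, sref α y⟫ = ⟪x, y⟫ := by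
  have h : ⟪α, α⟫ ≠ 0 := inner_self_ne_zero.mpr hα
  simp only [sref, inner_sub_left, inner_sub_right, real_inner_smul_left, real_inner_smul_right]
  rw [real_inner_comm y α]
  field_simp
  ring

lemma sref_sub_smul (α x y : V) (c : ℝ) : sref α (x - c • y) = sref α x - c • sref α y := by
  have h : 2 * ⟪x - c • y, α⟫ / ⟪α, α⟫ =
      2 * ⟪x, α⟫ / ⟪α, α⟫ - c * (2 * ⟪y, α⟫ / ⟪α, α⟫) := by
    rw [inner_sub_left, real_inner_smul_left]
    ring
  rw [sref, h, sref, sref]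
  module

/-- Conjugating the reflection in `sref γ α` by `sref γ` gives the reflection in `α`. -/
lemma sref_sref_sref {γ : V} (hγ : γ ≠ 0) (α x : V) :
    sref γ (sref (sref γ α) x) = sref α (sref γ x) := by
  have hx : ⟪x, sref γ α⟫ = ⟪sref γ x, α⟫ := by
    rw [← inner_sref_sref hγ, sref_sref hγ]
  rw [sref.eq_1 (sref γ α) x, sref_sub_smul, sref_sref hγ, inner_sref_sref hγ, hx, ← sref]

end Reflection

namespace RSD

variable {V : Type*} [NormedAddCommGroup V] [InnerProductSpace ℝ V] (S : RSD V)

lemma wordMap_cons (i : Fin S.n) (l : List (Fin S.n)) (x : V) :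
    S.wordMap (i :: l) x = sref (S.simple i) (S.wordMap l x) := rfl

lemma simple_ne_zero (i : Fin S.n) : S.simple i ≠ 0 :=
  S.root_ne_zero _ (S.pos_sub (S.simple_mem i))

lemma inner_wordMap (l : List (Fin S.n)) (x y : V) :
    ⟪S.wordMap l x, S.wordMap l y⟫ = ⟪x, y⟫ := by
  induction l with
  | nil => rfl
  | cons i t ih => rw [wordMap_cons, wordMap_cons, inner_sref_sref (S.simple_ne_zero i), ih]

lemma wordMap_mem_R (l : List (Fin S.n)) {α : V} (hα : α ∈ S.R) : S.wordMap l α ∈ S.R := by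
  induction l with
  | nil => exact hα
  | cons i t ih => exact S.refl_mem _ (S.pos_sub (S.simple_mem i)) _ ih

variable {S}

lemma Dominant.inner_nonneg {x α : V} (hx : S.Dominant x) (hα : α ∈ S.Rpos) : 0 ≤ ⟪x, α⟫ := by
  obtain ⟨c, rfl⟩ := S.pos_combo α hα
  rw [inner_sum]
  refine Finset.sum_nonneg fun i _ => ?_
  rw [real_inner_smul_right]
  exact mul_nonneg (Nat.cast_nonneg _) (hx i)

/-- A simple reflection permutes the positive roots other than its simple root. -/
lemma sref_simple_mem_Rpos {i : Fin S.n} {α : V} (hα : α ∈ S.Rpos) (hne : α ≠ S.simple i) :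
    sref (S.simple i) α ∈ S.Rpos := by
  have hi := S.pos_sub (S.simple_mem i)
  refine (S.pos_or_neg _ (S.refl_mem _ hi _ (S.pos_sub hα))).resolve_right fun hneg => hne ?_
  obtain ⟨c, hc⟩ := S.pos_combo α hα
  obtain ⟨d, hd⟩ := S.pos_combo _ hneg
  set k : ℝ := 2 * ⟪α, S.simple i⟫ / ⟪S.simple i, S.simple i⟫ with hk
  have hsum : ∑ j, ((c j : ℝ) + d j - if j = i then k else 0) • S.simple j = 0 := by
    simp only [sub_smul, add_smul, Finset.sum_sub_distrib, Finset.sum_add_distrib, ite_smul,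
      zero_smul, Finset.sum_ite_eq', Finset.mem_univ, if_true]
    rw [← hc, ← hd, sref, ← hk]
    abel
  have hcoef := Fintype.linearIndependent_iff.mp S.simple_indep _ hsum
  have hzero : ∀ j, j ≠ i → (c j : ℝ) = 0 := fun j hj => by
    have h := hcoef j
    rw [if_neg hj] at h
    linarith [Nat.cast_nonneg (α := ℝ) (c j), Nat.cast_nonneg (α := ℝ) (d j)]
  have hci : α = (c i : ℝ) • S.simple i := by
    rw [hc]
    refine Finset.sum_eq_single i (fun j _ hj => ?_) (by simp)
    rw [hzero j hj, zero_smul]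
  rcases S.reduced _ hi (c i) (hci ▸ S.pos_sub hα) with h | h
  · rw [hci, h, one_smul]
  · linarith [Nat.cast_nonneg (α := ℝ) (c i)]

/-- The strong exchange property: if a word sends a negative root to the positive root `α`,
then the reflection in `α` times the word is obtained by deleting a letter. -/
lemma exists_wordMap_eq_sref_wordMap (l : List (Fin S.n)) {α β : V} (hα : α ∈ S.Rpos)
    (hβ : -β ∈ S.Rpos) (h : S.wordMap l β = α) :
    ∃ l' : List (Fin S.n), l'.length < l.length ∧
      ∀ x, S.wordMap l' x = sref α (S.wordMap l x) := by
  induction l generalizing α with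
  | nil =>
    obtain rfl : β = α := h
    exact absurd hβ (S.not_both _ hα)
  | cons i t ih =>
    have hi := S.simple_ne_zero i
    by_cases hne : α = S.simple i
    · refine ⟨t, Nat.lt_succ_self _, fun x => ?_⟩
      rw [wordMap_cons, hne, sref_sref hi]
    · have ht : S.wordMap t β = sref (S.simple i) α := by
        rw [← h, wordMap_cons, sref_sref hi]
      obtain ⟨t', hlen, ht'⟩ := ih (sref_simple_mem_Rpos hα hne) ht
      refine ⟨i :: t', Nat.succ_lt_succ hlen, fun x => ?_⟩
      rw [wordMap_cons, wordMap_cons, ht', sref_sref_sref hi]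

lemma len_wordMap_le (l : List (Fin S.n)) : S.len (S.wordMap l) ≤ l.length :=
  Nat.sInf_le ⟨l, rfl, rfl⟩

lemma IsWeyl.exists_length_eq_len {w : V → V} (hw : S.IsWeyl w) :
    ∃ l : List (Fin S.n), l.length = S.len w ∧ w = S.wordMap l := by
  obtain ⟨l, hl⟩ := hw
  exact Nat.sInf_mem (s := {k | ∃ l : List (Fin S.n), l.length = k ∧ w = S.wordMap l})
    ⟨l.length, l, rfl, hl⟩

end RSD

/-- For `λ` in the root lattice `Q`, the inversion set of `w_λ⁻¹` is exactly
the set of positive roots having negative inner product with `λ`: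
`Π(w_λ⁻¹) = {α ∈ R⁺ : (λ, α) < 0}`. -/
theorem inversionSet_of_minWord_inv
    {V : Type*} [NormedAddCommGroup V] [InnerProductSpace ℝ V]
    (S : RSD V) (lam : V) (hlam : S.inQ lam)
    (lamp : V) (hdom : S.Dominant lamp) (horb : S.sameOrbit lam lamp)
    (w : V → V) (hw : S.IsMinWord lamp lam w)
    (wi : V → V) (hwiW : S.IsWeyl wi)
    (hwi : (∀ x, wi (w x) = x) ∧ ∀ x, w (wi x) = x) :
    S.PiSet wi = S.Rpos.filter (fun α => ⟪lam, α⟫ < 0) := by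
  obtain ⟨l, hlen, rfl⟩ := hw.1.exists_length_eq_len
  obtain ⟨-, hlp, hmin⟩ := hw
  ext α
  simp only [RSD.PiSet, Finset.mem_filter]
  refine and_congr_right fun hα => ?_
  have hinner : ⟪lam, α⟫ = ⟪lamp, wi α⟫ := by
    rw [← S.inner_wordMap l lamp, hlp, hwi.2]
  constructor
  · intro hneg
    have hle : ⟪lam, α⟫ ≤ 0 := by
      have := hdom.inner_nonneg hneg
      rw [inner_neg_right] at this
      linarith
    refine lt_of_le_of_ne hle fun h0 => ?_
    obtain ⟨l', hl', hmap⟩ := RSD.exists_wordMap_eq_sref_wordMap l hα hneg (hwi.2 α)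
    have h := hmin (S.wordMap l') ⟨l', rfl⟩
      (by rw [hmap, hlp, sref_eq_self_of_inner_eq_zero h0])
    have := RSD.len_wordMap_le (S := S) l'
    omega
  · intro hlt
    obtain ⟨m, rfl⟩ := hwiW
    refine (S.pos_or_neg _ (S.wordMap_mem_R m (S.pos_sub hα))).resolve_left fun hpos => ?_
    linarith [hdom.inner_nonneg hpos]

end
end

section
/- Let θ′ be a short root with (θ_s, θ′) = 0 such that μ := θ_s + θ′ is dominant and is not a root, and set A = {α ∈ R^+ : α is a short root, (θ_s, α^∨) = 1, and (θ′, α^∨) = 1}. Then the map α ↦ μ − α is a well-defined involution of A without fixed points; in particular the cardinality of A is even. -/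
open scoped RealInnerProductSpace

attribute [local instance] Classical.propDecidable

noncomputable section

/-- The set `A = {α ∈ R⁺ : α short, (θ_s, α^∨) = 1, (θ', α^∨) = 1}`. -/
def Aset {V : Type*} [NormedAddCommGroup V] [InnerProductSpace ℝ V]
    (S : RSD V) (θs θ' : V) : Finset V :=
  S.Rpos.filter (fun α => S.IsShort α ∧ ⟪θs, coroot α⟫ = 1 ∧ ⟪θ', coroot α⟫ = 1)

/-- A root having positive inner product with a dominant vector is positive. -/
lemma RSD.mem_Rpos_of_dominant_of_inner_pos
    {V : Type*} [NormedAddCommGroup V] [InnerProductSpace ℝ V]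
    (S : RSD V) {x β : V} (hx : S.Dominant x) (hβ : β ∈ S.R) (h : 0 < ⟪x, β⟫) :
    β ∈ S.Rpos := by
  refine (S.pos_or_neg β hβ).resolve_right fun hneg => ?_
  obtain ⟨c, hc⟩ := S.pos_combo _ hneg
  have h₁ : 0 ≤ ⟪x, -β⟫ := by
    rw [hc, inner_sum]
    refine Finset.sum_nonneg fun i _ => ?_
    rw [real_inner_smul_right]
    exact mul_nonneg (Nat.cast_nonneg _) (hx i)
  rw [inner_neg_right] at h₁
  linarith

/-- Pairing with the coroot of `α` equals one exactly when the inner product with `α` is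
half of the squared length. -/
lemma inner_coroot_eq_one_iff
    {V : Type*} [NormedAddCommGroup V] [InnerProductSpace ℝ V]
    {α : V} (hα : α ≠ 0) (x : V) :
    ⟪x, coroot α⟫ = 1 ↔ ⟪x, α⟫ = ⟪α, α⟫ / 2 := by
  have h : ⟪α, α⟫ ≠ 0 := inner_self_ne_zero.mpr hα
  rw [coroot, real_inner_smul_right]
  field_simp

/-- The reflection in `α` subtracts `ε • α` from a vector pairing to `ε` with its coroot. -/
lemma sref_eq_sub_of_inner_eq
    {V : Type*} [NormedAddCommGroup V] [InnerProductSpace ℝ V]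
    {α x : V} (hα : α ≠ 0) (ε : ℝ) (h : ⟪x, α⟫ = ε * ⟪α, α⟫ / 2) :
    sref α x = x - ε • α := by
  have h' : ⟪α, α⟫ ≠ 0 := inner_self_ne_zero.mpr hα
  rw [sref, h]
  congr 2
  field_simp

/-- Short roots all have the same length. -/
lemma RSD.IsShort.inner_self_eq
    {V : Type*} [NormedAddCommGroup V] [InnerProductSpace ℝ V]
    {S : RSD V} {α β : V} (hα : S.IsShort α) (hβ : S.IsShort β) : ⟪α, α⟫ = ⟪β, β⟫ :=
  le_antisymm (hα.2 β hβ.1) (hβ.2 α hα.1)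

/-- A finite set with a fixed-point-free involution of the form `a ↦ m - a` has even
cardinality. -/
lemma Finset.even_card_of_sub_mem {G : Type*} [AddCommGroup G] (s : Finset G) (m : G)
    (hmem : ∀ a ∈ s, m - a ∈ s) (hne : ∀ a ∈ s, m - a ≠ a) : Even s.card := by
  have h : ∑ _a ∈ s, (1 : ZMod 2) = 0 :=
    Finset.sum_involution (fun a _ => m - a) (fun _ _ => by decide)
      (fun a ha _ => hne a ha) hmem (fun a _ => sub_sub_cancel m a)
  rw [Finset.sum_const, nsmul_one] at h
  exact (ZMod.natCast_eq_zero_iff_even).mp h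

/-- Let `θ'` be a short root orthogonal to the highest short root `θ_s`
such that `μ = θ_s + θ'` is dominant and not a root. Then `α ↦ μ − α` is a well-defined
involution of `A` without fixed points; in particular `|A|` is even. -/
theorem involution_on_A
    {V : Type*} [NormedAddCommGroup V] [InnerProductSpace ℝ V]
    (S : RSD V) (θs : V)
    (hθs : S.IsShort θs ∧ S.Dominant θs ∧ ∀ β : V, S.IsShort β → S.htZ β ≤ S.htZ θs)
    (θ' : V) (hθ' : S.IsShort θ') (hperp : ⟪θs, θ'⟫ = 0)
    (hdom : S.Dominant (θs + θ')) (hnotroot : θs + θ' ∉ S.R) :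
    (∀ α ∈ Aset S θs θ', (θs + θ') - α ∈ Aset S θs θ') ∧
      (∀ α ∈ Aset S θs θ', (θs + θ') - α ≠ α) ∧
      Even (Aset S θs θ').card := by
  have hmem : ∀ α ∈ Aset S θs θ', (θs + θ') - α ∈ Aset S θs θ' := by
    intro α hα
    obtain ⟨-, hshort, h₁, h₂⟩ := Finset.mem_filter.mp hα
    have hα₀ := S.root_ne_zero α hshort.1
    have hθ'₀ := S.root_ne_zero θ' hθ'.1
    rw [inner_coroot_eq_one_iff hα₀] at h₁ h₂
    have hs := hθs.1.inner_self_eq hshort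
    have h' := hθ'.inner_self_eq hshort
    have hpos : 0 < ⟪α, α⟫ := real_inner_self_pos.mpr hα₀
    have hroot : (θs + θ') - α ∈ S.R := by
      have hsub : θs - α ∈ S.R := by
        have := S.refl_mem α hshort.1 θs hθs.1.1
        rwa [sref_eq_sub_of_inner_eq hα₀ 1 (by rw [h₁, one_mul]), one_smul] at this
      have := S.refl_mem θ' hθ'.1 _ hsub
      rw [sref_eq_sub_of_inner_eq hθ'₀ (-1) (by
        rw [inner_sub_left, hperp, real_inner_comm, h₂, h']; ring)] at this
      convert this using 1
      module
    have hswap : ⟪θ', θs⟫ = 0 := by rw [real_inner_comm, hperp]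
    have hα₁ : ⟪α, θs⟫ = ⟪α, α⟫ / 2 := by rw [real_inner_comm, h₁]
    have hα₂ : ⟪α, θ'⟫ = ⟪α, α⟫ / 2 := by rw [real_inner_comm, h₂]
    have hself : ⟪(θs + θ') - α, (θs + θ') - α⟫ = ⟪α, α⟫ := by
      simp only [inner_sub_left, inner_sub_right, inner_add_left, inner_add_right]
      linarith
    have hroot₀ := S.root_ne_zero _ hroot
    refine Finset.mem_filter.mpr ⟨S.mem_Rpos_of_dominant_of_inner_pos hdom hroot ?_,
      ⟨hroot, hself.symm ▸ hshort.2⟩, ?_, ?_⟩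
    · simp only [inner_sub_right, inner_add_left, inner_add_right]
      linarith
    · rw [inner_coroot_eq_one_iff hroot₀, hself, inner_sub_right, inner_add_right]
      linarith
    · rw [inner_coroot_eq_one_iff hroot₀, hself, inner_sub_right, inner_add_right]
      linarith
  have hne : ∀ α ∈ Aset S θs θ', (θs + θ') - α ≠ α := by
    intro α hα heq
    obtain ⟨-, hshort, h₁, -⟩ := Finset.mem_filter.mp hα
    have hα₀ := S.root_ne_zero α hshort.1
    rw [inner_coroot_eq_one_iff hα₀] at h₁
    have hs := hθs.1.inner_self_eq hshort
    have hpos : 0 < ⟪α, α⟫ := real_inner_self_pos.mpr hα₀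
    have hθα : θ' = α + α - θs := by rw [← sub_eq_iff_eq_add.mp heq]; abel
    have h' := hθ'.inner_self_eq hshort
    have hα₁ : ⟪α, θs⟫ = ⟪α, α⟫ / 2 := by rw [real_inner_comm, h₁]
    rw [hθα] at h'
    simp only [inner_sub_left, inner_sub_right, inner_add_left, inner_add_right] at h'
    rw [hθα, inner_sub_right, inner_add_right] at hperp
    linarith
  exact ⟨hmem, hne, Finset.even_card_of_sub_mem _ _ hmem hne⟩

end
end
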